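/- arXiv:2304.09000 — 3 statements merged into one kernel-verified Lean document; each statement's English description precedes it below -/
import Mathlib

section
/- Let C be a category with finite limits that is finitary extensive, and let W be a class of morphisms of C that contains all isomorphisms, satisfies the two-out-of-three property (for composable f, g, if two of f, g, g ∘ f lie in W then so does the third), is stable under pullback (any pullback of a morphism in W lies in W), and is stable under finite coproducts (if f and g lie in W then so does f ⊕ g : a ⊕ c → b ⊕ d). Then the localization C[W⁻¹] of C at W has finite limits and is finitary extensive, the localization functor P : C ⥤ C[W⁻¹] preserves finite limits and finite coproducts, and for any category B with finite limits and finite coproducts and any functor G : C[W⁻¹] ⥤ B, G preserves finite limits and finite coproducts if and only if G ∘ P does. -/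
open CategoryTheory CategoryTheory.Limits Opposite

universe w v u v₂ u₂ v₃ u₃

namespace CategoryTheory

section Whiskering

variable {C D B J : Type*} [Category* C] [Category* D] [Category* B] [Category* J]
  (L : C ⥤ D)

lemma Functor.hasLimitsOfShape_of_essSurj_whiskeringRight [HasLimitsOfShape J C]
    [PreservesLimitsOfShape J L] [((whiskeringRight J C D).obj L).EssSurj] :
    HasLimitsOfShape J D where
  has_limit K := by
    let e : _ ⋙ L ≅ K := ((whiskeringRight J C D).obj L).objObjPreimageIso K
    exact hasLimit_of_iso e

lemma Functor.hasColimitsOfShape_of_essSurj_whiskeringRight [HasColimitsOfShape J C]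
    [PreservesColimitsOfShape J L] [((whiskeringRight J C D).obj L).EssSurj] :
    HasColimitsOfShape J D where
  has_colimit K := by
    let e : _ ⋙ L ≅ K := ((whiskeringRight J C D).obj L).objObjPreimageIso K
    exact hasColimit_of_iso e.symm

lemma Functor.preservesLimitsOfShape_of_comp [HasLimitsOfShape J C]
    [PreservesLimitsOfShape J L] [((whiskeringRight J C D).obj L).EssSurj]
    (G : D ⥤ B) [PreservesLimitsOfShape J (L ⋙ G)] :
    PreservesLimitsOfShape J G where
  preservesLimit {K} := by
    let K' := ((whiskeringRight J C D).obj L).objPreimage K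
    let e : K' ⋙ L ≅ K := ((whiskeringRight J C D).obj L).objObjPreimageIso K
    have : PreservesLimit (K' ⋙ L) G :=
      preservesLimit_of_preserves_limit_cone (isLimitOfPreserves L (limit.isLimit K'))
        (isLimitOfPreserves (L ⋙ G) (limit.isLimit K'))
    exact preservesLimit_of_iso_diagram G e

lemma Functor.preservesColimitsOfShape_of_comp [HasColimitsOfShape J C]
    [PreservesColimitsOfShape J L] [((whiskeringRight J C D).obj L).EssSurj]
    (G : D ⥤ B) [PreservesColimitsOfShape J (L ⋙ G)] :
    PreservesColimitsOfShape J G where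
  preservesColimit {K} := by
    let K' := ((whiskeringRight J C D).obj L).objPreimage K
    let e : K' ⋙ L ≅ K := ((whiskeringRight J C D).obj L).objObjPreimageIso K
    have : PreservesColimit (K' ⋙ L) G :=
      preservesColimit_of_preserves_colimit_cocone
        (isColimitOfPreserves L (colimit.isColimit K'))
        (isColimitOfPreserves (L ⋙ G) (colimit.isColimit K'))
    exact preservesColimit_of_iso_diagram G e

instance Functor.essSurj_whiskeringRight_discrete (I : Type*) [L.EssSurj] :
    ((whiskeringRight (Discrete I) C D).obj L).EssSurj where
  mem_essImage K := ⟨Discrete.functor fun i ↦ L.objPreimage (K.obj ⟨i⟩),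
    ⟨Discrete.natIso fun i ↦ L.objObjPreimageIso (K.obj i)⟩⟩

end Whiskering

lemma FinitaryExtensive.isPullback_inl_map {C : Type*} [Category* C] [FinitaryExtensive C]
    {X Y X' Y' : C} (f : X' ⟶ X) (g : Y' ⟶ Y) :
    IsPullback coprod.inl f (coprod.map f g) coprod.inl :=
  (((BinaryCofan.isVanKampen_iff _).1
    (FinitaryExtensive.van_kampen' _ (coprodIsCoprod X Y))
    (BinaryCofan.mk coprod.inl coprod.inr) f g (coprod.map f g)
      (coprod.inl_map f g).symm (coprod.inr_map f g).symm).1 ⟨coprodIsCoprod X' Y'⟩).1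

lemma FinitaryExtensive.isPullback_inr_map {C : Type*} [Category* C] [FinitaryExtensive C]
    {X Y X' Y' : C} (f : X' ⟶ X) (g : Y' ⟶ Y) :
    IsPullback coprod.inr g (coprod.map f g) coprod.inr :=
  (((BinaryCofan.isVanKampen_iff _).1
    (FinitaryExtensive.van_kampen' _ (coprodIsCoprod X Y))
    (BinaryCofan.mk coprod.inl coprod.inr) f g (coprod.map f g)
      (coprod.inl_map f g).symm (coprod.inr_map f g).symm).1 ⟨coprodIsCoprod X' Y'⟩).2

lemma FinitaryExtensive.nonempty_isColimit_of_isPullback {C : Type*} [Category* C]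
    [FinitaryExtensive C] {X Y X' Y' Z : C} {f : Z ⟶ X ⨿ Y}
    {i : X' ⟶ Z} {j : Y' ⟶ Z} {a : X' ⟶ X} {b : Y' ⟶ Y}
    (hi : IsPullback i a f coprod.inl) (hj : IsPullback j b f coprod.inr) :
    Nonempty (IsColimit (BinaryCofan.mk i j)) :=
  ((BinaryCofan.isVanKampen_iff _).1
    (FinitaryExtensive.van_kampen' _ (coprodIsCoprod X Y))
    (BinaryCofan.mk i j) a b f hi.w.symm hj.w.symm).2 ⟨hi, hj⟩

lemma Limits.BinaryCofan.nonempty_isColimit_of_iso {C : Type*} [Category* C] {X Y X' Y' Z Z' : C}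
    {i : X ⟶ Z} {j : Y ⟶ Z} {i' : X' ⟶ Z'} {j' : Y' ⟶ Z'}
    (h : IsColimit (BinaryCofan.mk i j)) (eX : X ≅ X') (eY : Y ≅ Y') (e : Z ≅ Z')
    (hi : i ≫ e.hom = eX.hom ≫ i') (hj : j ≫ e.hom = eY.hom ≫ j') :
    Nonempty (IsColimit (BinaryCofan.mk i' j')) := by
  have hi' : (eX.inv ≫ i) ≫ e.hom = i' := by simp [hi]
  have hj' : (eY.inv ≫ j) ≫ e.hom = j' := by simp [hj]
  exact ⟨IsColimit.ofIsoColimit (BinaryCofan.isColimitCompRightIso _ eY.inv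
    (BinaryCofan.isColimitCompLeftIso _ eX.inv h)) (BinaryCofan.ext e hi' hj')⟩

namespace MorphismProperty

variable {C : Type*} [Category* C] (W : MorphismProperty C)

lemma diagonal_mem [HasPullbacks C] [W.ContainsIdentities] [W.HasOfPostcompProperty W]
    [W.IsStableUnderBaseChange] {X Y : C} (f : X ⟶ Y) (hf : W f) : W (pullback.diagonal f) :=
  W.of_postcomp _ (pullback.fst f f) (W.pullback_fst _ _ hf) (by simpa using W.id_mem X)

/-- A class of morphisms which is multiplicative, stable under base change and satisfies
the right cancellation property has a right calculus of fractions. -/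
lemma hasRightCalculusOfFractions_of_isStableUnderBaseChange [HasPullbacks C]
    [W.IsMultiplicative] [W.HasOfPostcompProperty W] [W.IsStableUnderBaseChange] :
    W.HasRightCalculusOfFractions where
  exists_rightFraction _ _ φ :=
    ⟨.mk (pullback.fst φ.f φ.s) (W.pullback_fst _ _ φ.hs) (pullback.snd φ.f φ.s),
      pullback.condition⟩
  ext X Y Y' f₁ f₂ s hs h := by
    refine ⟨_, pullback.fst (pullback.lift f₁ f₂ h) (pullback.diagonal s),
      W.pullback_fst _ _ (W.diagonal_mem s hs), ?_⟩
    have h₁ := pullback.condition (f := pullback.lift f₁ f₂ h) (g := pullback.diagonal s)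
    have h₂ := congr($h₁ ≫ pullback.fst s s)
    have h₃ := congr($h₁ ≫ pullback.snd s s)
    simp only [Category.assoc, pullback.lift_fst, pullback.lift_snd, pullback.diagonal_fst,
      pullback.diagonal_snd] at h₂ h₃
    rw [h₂, h₃]

end MorphismProperty

namespace Localization

variable {C D : Type*} [Category* C] [Category* D] (L : C ⥤ D) (W : MorphismProperty C)
  [L.IsLocalization W]

section RightCalculus

variable [W.HasRightCalculusOfFractions]

lemma exists_map_comp_eq_map {X Y : C} (f : L.obj X ⟶ L.obj Y) :
    ∃ (X' : C) (s : X' ⟶ X) (_ : W s) (g : X' ⟶ Y), L.map s ≫ f = L.map g := by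
  obtain ⟨φ, rfl⟩ := exists_rightFraction L W f
  exact ⟨_, φ.s, φ.hs, φ.f, φ.map_s_comp_map L (inverts L W)⟩

lemma exists_map_comp_eq_map₂ {X Y Z : C} (f : L.obj X ⟶ L.obj Y) (g : L.obj X ⟶ L.obj Z) :
    ∃ (X' : C) (s : X' ⟶ X) (_ : W s) (f' : X' ⟶ Y) (g' : X' ⟶ Z),
      L.map s ≫ f = L.map f' ∧ L.map s ≫ g = L.map g' := by
  obtain ⟨X₁, s, hs, f', hf⟩ := exists_map_comp_eq_map L W f
  obtain ⟨X₂, t, ht, g', hg⟩ := exists_map_comp_eq_map L W (L.map s ≫ g)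
  exact ⟨X₂, t ≫ s, W.comp_mem _ _ ht hs, t ≫ f', g', by simp [hf], by simp [hg]⟩

include W in
lemma exists_iso_hom_comp_eq_map {A : D} {Y : C} (f : A ⟶ L.obj Y) :
    ∃ (X : C) (e : L.obj X ≅ A) (f' : X ⟶ Y), e.hom ≫ f = L.map f' := by
  have := essSurj L W
  obtain ⟨X, s, hs, f', hf⟩ := exists_map_comp_eq_map L W ((L.objObjPreimageIso A).hom ≫ f)
  exact ⟨X, isoOfHom L W s hs ≪≫ L.objObjPreimageIso A, f', by simp [hf]⟩

include W in
lemma exists_iso_hom_comp_eq_map₂ {A : D} {Y Z : C} (f : A ⟶ L.obj Y) (g : A ⟶ L.obj Z) :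
    ∃ (X : C) (e : L.obj X ≅ A) (f' : X ⟶ Y) (g' : X ⟶ Z),
      e.hom ≫ f = L.map f' ∧ e.hom ≫ g = L.map g' := by
  have := essSurj L W
  obtain ⟨X, s, hs, f', g', hf, hg⟩ := exists_map_comp_eq_map₂ L W
    ((L.objObjPreimageIso A).hom ≫ f) ((L.objObjPreimageIso A).hom ≫ g)
  exact ⟨X, isoOfHom L W s hs ≪≫ L.objObjPreimageIso A, f', g', by simp [hf], by simp [hg]⟩

include W in
lemma essSurj_whiskeringRight_walkingCospan :
    ((Functor.whiskeringRight WalkingCospan C D).obj L).EssSurj where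
  mem_essImage K := by
    have := essSurj L W
    let e := L.objObjPreimageIso (K.obj .one)
    obtain ⟨X, eX, f, hf⟩ := exists_iso_hom_comp_eq_map L W (K.map WalkingCospan.Hom.inl ≫ e.inv)
    obtain ⟨Y, eY, g, hg⟩ := exists_iso_hom_comp_eq_map L W (K.map WalkingCospan.Hom.inr ≫ e.inv)
    exact ⟨cospan f g, ⟨cospanCompIso L f g ≪≫
      cospanExt eX eY e (by simp [← hf]) (by simp [← hg]) ≪≫ (diagramIsoCospan K).symm⟩⟩

include W in
lemma isPullback_map {P X Y Z : C} {fst : P ⟶ X} {snd : P ⟶ Y} {f : X ⟶ Z} {g : Y ⟶ Z}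
    (h : IsPullback fst snd f g) :
    IsPullback (L.map fst) (L.map snd) (L.map f) (L.map g) := by
  have hext {T : D} (u v : T ⟶ L.obj P) (h₁ : u ≫ L.map fst = v ≫ L.map fst)
      (h₂ : u ≫ L.map snd = v ≫ L.map snd) : u = v := by
    obtain ⟨T', e, u', v', hu, hv⟩ := exists_iso_hom_comp_eq_map₂ L W u v
    have h₁' : L.map (u' ≫ fst) = L.map (v' ≫ fst) := by simp [← hu, ← hv, h₁]
    obtain ⟨T₁, s, hs, hs'⟩ := (MorphismProperty.map_eq_iff_precomp L W _ _).1 h₁'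
    have h₂' : L.map (s ≫ u' ≫ snd) = L.map (s ≫ v' ≫ snd) := by simp [← hu, ← hv, h₂]
    obtain ⟨T₂, t, ht, ht'⟩ := (MorphismProperty.map_eq_iff_precomp L W _ _).1 h₂'
    rw [← cancel_epi e.hom, hu, hv, MorphismProperty.map_eq_iff_precomp L W]
    refine ⟨T₂, t ≫ s, W.comp_mem _ _ ht hs, h.hom_ext ?_ ?_⟩
    · simp only [Category.assoc, hs']
    · simpa only [Category.assoc] using ht'
  have hlift {T : D} (a : T ⟶ L.obj X) (b : T ⟶ L.obj Y) (w : a ≫ L.map f = b ≫ L.map g) :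
      ∃ l : T ⟶ L.obj P, l ≫ L.map fst = a ∧ l ≫ L.map snd = b := by
    obtain ⟨T', e, a', b', ha, hb⟩ := exists_iso_hom_comp_eq_map₂ L W a b
    have w' : L.map (a' ≫ f) = L.map (b' ≫ g) := by simp [← ha, ← hb, w]
    obtain ⟨T₁, s, hs, hs'⟩ := (MorphismProperty.map_eq_iff_precomp L W _ _).1 w'
    have := inverts L W s hs
    refine ⟨e.inv ≫ inv (L.map s) ≫
      L.map (h.lift (s ≫ a') (s ≫ b') (by simpa only [Category.assoc] using hs')), ?_, ?_⟩
    · simp [← L.map_comp, ← ha]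
    · simp [← L.map_comp, ← hb]
  exact .mk' (by rw [← L.map_comp, h.w, L.map_comp]) (fun _ u v ↦ hext u v) (fun _ ↦ hlift)

include W in
lemma preservesLimitsOfShape_walkingCospan [HasPullbacks C] :
    PreservesLimitsOfShape WalkingCospan L where
  preservesLimit {K} := by
    have h := IsPullback.of_hasPullback (K.map WalkingCospan.Hom.inl) (K.map WalkingCospan.Hom.inr)
    have : PreservesLimit (cospan (K.map WalkingCospan.Hom.inl) (K.map WalkingCospan.Hom.inr)) L :=
      preservesLimit_of_preserves_limit_cone h.isLimit
        ((isLimitMapConePullbackConeEquiv L h.w).symm (isPullback_map L W h).isLimit)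
    exact preservesLimit_of_iso_diagram L (diagramIsoCospan K).symm

include W in
lemma nonempty_isTerminal_obj {T : C} (hT : IsTerminal T) : Nonempty (IsTerminal (L.obj T)) := by
  have := essSurj L W
  refine ⟨IsTerminal.ofUniqueHom
    (fun A ↦ (L.objObjPreimageIso A).inv ≫ L.map (hT.from _)) fun A m ↦ ?_⟩
  obtain ⟨X, s, hs, f, hf⟩ := exists_map_comp_eq_map L W ((L.objObjPreimageIso A).hom ≫ m)
  have := inverts L W s hs
  rw [Iso.eq_inv_comp, ← cancel_epi (L.map s), hf, ← L.map_comp]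
  congr 1
  exact hT.hom_ext _ _

include W in
lemma preservesFiniteLimits_of_hasRightCalculusOfFractions [HasFiniteLimits C] :
    PreservesFiniteLimits L := by
  have : PreservesLimit (Functor.empty.{0} C) L :=
    preservesLimit_of_preserves_limit_cone terminalIsTerminal
      ((isLimitMapConeEmptyConeEquiv L _).symm
        (nonempty_isTerminal_obj L W terminalIsTerminal).some)
  have := preservesLimitsOfShape_pempty_of_preservesTerminal L
  have := preservesLimitsOfShape_walkingCospan L W
  exact preservesFiniteLimits_of_preservesTerminal_and_pullbacks L

include L W in
lemma hasFiniteLimits_of_hasRightCalculusOfFractions [HasFiniteLimits C] : HasFiniteLimits D := by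
  have := essSurj L W
  have := essSurj_whiskeringRight_walkingCospan L W
  have := preservesFiniteLimits_of_hasRightCalculusOfFractions L W
  have : HasPullbacks D := L.hasLimitsOfShape_of_essSurj_whiskeringRight
  have : HasTerminal D := L.hasLimitsOfShape_of_essSurj_whiskeringRight
  exact hasFiniteLimits_of_hasTerminal_and_pullbacks

include W in
lemma preservesFiniteLimits_of_comp [HasFiniteLimits C] {B : Type*} [Category* B] (G : D ⥤ B)
    [PreservesFiniteLimits (L ⋙ G)] : PreservesFiniteLimits G := by
  have := essSurj L W
  have := essSurj_whiskeringRight_walkingCospan L W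
  have := preservesFiniteLimits_of_hasRightCalculusOfFractions L W
  have := hasFiniteLimits_of_hasRightCalculusOfFractions L W
  have : PreservesLimitsOfShape WalkingCospan G := L.preservesLimitsOfShape_of_comp G
  have : PreservesLimitsOfShape (Discrete.{0} PEmpty) G := L.preservesLimitsOfShape_of_comp G
  exact preservesFiniteLimits_of_preservesTerminal_and_pullbacks G

end RightCalculus

section Extensive

variable [FinitaryExtensive C] [W.HasRightCalculusOfFractions]

include W in
lemma nonempty_isInitial_obj {I : C} (hI : IsInitial I) : Nonempty (IsInitial (L.obj I)) := by
  have := essSurj L W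
  refine ⟨IsInitial.ofUniqueHom
    (fun A ↦ L.map (hI.to _) ≫ (L.objObjPreimageIso A).hom) fun A m ↦ ?_⟩
  obtain ⟨X, s, hs, f, hf⟩ := exists_map_comp_eq_map L W (m ≫ (L.objObjPreimageIso A).inv)
  have := inverts L W s hs
  have := hI.isIso_to s
  rw [← Iso.comp_inv_eq, ← cancel_epi (L.map s), hf, ← L.map_comp]
  congr 1
  exact (hI.ofIso (asIso s).symm).hom_ext _ _

variable (hW : ∀ {a b a' b' : C} (f : a ⟶ b) (g : a' ⟶ b'), W f → W g → W (coprod.map f g))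

include hW in
lemma exists_desc_of_coprod {X Y : C} {A : D} (f : L.obj X ⟶ A) (g : L.obj Y ⟶ A) :
    ∃ l : L.obj (X ⨿ Y) ⟶ A, L.map coprod.inl ≫ l = f ∧ L.map coprod.inr ≫ l = g := by
  have := essSurj L W
  let e := L.objObjPreimageIso A
  obtain ⟨X', s, hs, f', hf⟩ := exists_map_comp_eq_map L W (f ≫ e.inv)
  obtain ⟨Y', t, ht, g', hg⟩ := exists_map_comp_eq_map L W (g ≫ e.inv)
  have := inverts L W s hs
  have := inverts L W t ht
  have := inverts L W _ (hW s t hs ht)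
  refine ⟨inv (L.map (coprod.map s t)) ≫ L.map (coprod.desc f' g') ≫ e.hom, ?_, ?_⟩
  · have : L.map coprod.inl ≫ inv (L.map (coprod.map s t)) =
        inv (L.map s) ≫ L.map coprod.inl := by
      rw [IsIso.comp_inv_eq, Category.assoc, IsIso.eq_inv_comp, ← L.map_comp, ← L.map_comp,
        coprod.inl_map]
    rw [reassoc_of% this, ← L.map_comp_assoc, coprod.inl_desc, ← hf]
    simp
  · have : L.map coprod.inr ≫ inv (L.map (coprod.map s t)) =
        inv (L.map t) ≫ L.map coprod.inr := by
      rw [IsIso.comp_inv_eq, Category.assoc, IsIso.eq_inv_comp, ← L.map_comp, ← L.map_comp,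
        coprod.inr_map]
    rw [reassoc_of% this, ← L.map_comp_assoc, coprod.inr_desc, ← hg]
    simp

variable [W.IsStableUnderBaseChange]

include hW in
lemma hom_ext_of_coprod {X Y : C} {A : D} {u v : L.obj (X ⨿ Y) ⟶ A}
    (hl : L.map coprod.inl ≫ u = L.map coprod.inl ≫ v)
    (hr : L.map coprod.inr ≫ u = L.map coprod.inr ≫ v) : u = v := by
  have := essSurj L W
  let e := L.objObjPreimageIso A
  obtain ⟨Z, s, hs, u', v', hu, hv⟩ := exists_map_comp_eq_map₂ L W (u ≫ e.inv) (v ≫ e.inv)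
  have := inverts L W s hs
  have pl := IsPullback.of_hasPullback s (coprod.inl : X ⟶ X ⨿ Y)
  have pr := IsPullback.of_hasPullback s (coprod.inr : Y ⟶ X ⨿ Y)
  obtain ⟨hc⟩ := FinitaryExtensive.nonempty_isColimit_of_isPullback pl pr
  have hl' : L.map (pullback.fst s coprod.inl ≫ u') = L.map (pullback.fst s coprod.inl ≫ v') := by
    simp only [L.map_comp, ← hu, ← hv]
    simp only [← L.map_comp_assoc, pl.w]
    simp only [L.map_comp, Category.assoc, reassoc_of% hl]
  have hr' : L.map (pullback.fst s coprod.inr ≫ u') = L.map (pullback.fst s coprod.inr ≫ v') := by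
    simp only [L.map_comp, ← hu, ← hv]
    simp only [← L.map_comp_assoc, pr.w]
    simp only [L.map_comp, Category.assoc, reassoc_of% hr]
  obtain ⟨X', t, ht, ht'⟩ := (MorphismProperty.map_eq_iff_precomp L W _ _).1 hl'
  obtain ⟨Y', t₂, ht₂, ht₂'⟩ := (MorphismProperty.map_eq_iff_precomp L W _ _).1 hr'
  let i : pullback s coprod.inl ⨿ pullback s coprod.inr ≅ Z :=
    (coprodIsCoprod _ _).coconePointUniqueUpToIso hc
  have hil : coprod.inl ≫ i.hom = pullback.fst s coprod.inl :=
    (coprodIsCoprod _ _).comp_coconePointUniqueUpToIso_hom hc ⟨.left⟩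
  have hir : coprod.inr ≫ i.hom = pullback.fst s coprod.inr :=
    (coprodIsCoprod _ _).comp_coconePointUniqueUpToIso_hom hc ⟨.right⟩
  rw [← cancel_mono e.inv, ← cancel_epi (L.map s), hu, hv,
    MorphismProperty.map_eq_iff_precomp L W]
  refine ⟨_, coprod.map t t₂ ≫ i.hom,
    W.comp_mem _ _ (hW t t₂ ht ht₂) (W.of_isIso i.hom), coprod.hom_ext ?_ ?_⟩
  · simpa [reassoc_of% hil] using ht'
  · simpa [reassoc_of% hir] using ht₂'

include hW in
lemma nonempty_isColimit_map_coprod (X Y : C) :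
    Nonempty (IsColimit (BinaryCofan.mk (L.map (coprod.inl : X ⟶ X ⨿ Y)) (L.map coprod.inr))) :=
  ⟨BinaryCofan.IsColimit.mk _
    (fun f g ↦ (exists_desc_of_coprod L W hW f g).choose)
    (fun f g ↦ (exists_desc_of_coprod L W hW f g).choose_spec.1)
    (fun f g ↦ (exists_desc_of_coprod L W hW f g).choose_spec.2)
    (fun f g _ hf hg ↦ hom_ext_of_coprod L W hW
      (hf.trans (exists_desc_of_coprod L W hW f g).choose_spec.1.symm)
      (hg.trans (exists_desc_of_coprod L W hW f g).choose_spec.2.symm))⟩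

include hW in
lemma preservesFiniteCoproducts_of_finitaryExtensive : PreservesFiniteCoproducts L := by
  have : PreservesColimit (Functor.empty.{0} C) L :=
    preservesColimit_of_preserves_colimit_cocone initialIsInitial
      ((isColimitMapCoconeEmptyCoconeEquiv L _).symm
        (nonempty_isInitial_obj L W initialIsInitial).some)
  have := preservesColimitsOfShape_pempty_of_preservesInitial L
  have : PreservesColimitsOfShape (Discrete WalkingPair) L :=
    { preservesColimit := fun {K} ↦ by
        have : PreservesColimit (pair (K.obj ⟨.left⟩) (K.obj ⟨.right⟩)) L :=
          preservesColimit_of_preserves_colimit_cocone (coprodIsCoprod _ _)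
            (BinaryCofan.isColimitMapConeEquiv.symm
              (nonempty_isColimit_map_coprod L W hW _ _).some)
        exact preservesColimit_of_iso_diagram L (diagramIsoPair K).symm }
  exact ⟨fun _ ↦ PreservesFiniteCoproducts.of_preserves_binary_and_initial L _⟩

include L hW in
lemma hasFiniteCoproducts_of_finitaryExtensive : HasFiniteCoproducts D := by
  have := essSurj L W
  have := preservesFiniteCoproducts_of_finitaryExtensive L W hW
  exact ⟨fun _ ↦ L.hasColimitsOfShape_of_essSurj_whiskeringRight⟩

include hW in
lemma preservesFiniteCoproducts_of_comp {B : Type*} [Category* B] (G : D ⥤ B)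
    [PreservesFiniteCoproducts (L ⋙ G)] : PreservesFiniteCoproducts G := by
  have := essSurj L W
  have := preservesFiniteCoproducts_of_finitaryExtensive L W hW
  exact ⟨fun _ ↦ L.preservesColimitsOfShape_of_comp G⟩

include L hW in
lemma finitaryExtensive [HasFiniteLimits C] : FinitaryExtensive D := by
  have := essSurj L W
  have := hasFiniteLimits_of_hasRightCalculusOfFractions L W
  have := hasFiniteCoproducts_of_finitaryExtensive L W hW
  obtain ⟨hT⟩ := nonempty_isTerminal_obj L W (terminalIsTerminal (C := C))
  obtain ⟨hc⟩ := nonempty_isColimit_map_coprod L W hW (⊤_ C) (⊤_ C)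
  have hcofan (X Y : D) : Nonempty (IsColimit (BinaryCofan.mk
      ((L.objObjPreimageIso X).inv ≫ L.map coprod.inl)
      ((L.objObjPreimageIso Y).inv ≫ L.map coprod.inr))) :=
    BinaryCofan.nonempty_isColimit_of_iso
      (nonempty_isColimit_map_coprod L W hW (L.objPreimage X) (L.objPreimage Y)).some
      (L.objObjPreimageIso X) (L.objObjPreimageIso Y) (Iso.refl _) (by simp) (by simp)
  rw [finitaryExtensive_iff_of_isTerminal D _ hT _ hc]
  refine BinaryCofan.isVanKampen_mk _ _ (fun X Y ↦ (hcofan X Y).some)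
    (fun f g ↦ pullback.cone f g) (fun f g ↦ pullback.isLimit f g) ?_ ?_
  · intro X Y αX αY f hX hY
    change L.obj (L.objPreimage X ⨿ L.objPreimage Y) ⟶ L.obj ((⊤_ C) ⨿ ⊤_ C) at f
    change αX ≫ L.map coprod.inl = ((L.objObjPreimageIso X).inv ≫ L.map coprod.inl) ≫ f at hX
    change αY ≫ L.map coprod.inr = ((L.objObjPreimageIso Y).inv ≫ L.map coprod.inr) ≫ f at hY
    have hf : f = L.map (coprod.map (terminal.from _) (terminal.from _)) := by
      refine hom_ext_of_coprod L W hW ?_ ?_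
      · rw [← L.map_comp, coprod.inl_map, ← cancel_epi (L.objObjPreimageIso X).inv,
          ← Category.assoc, ← hX, L.map_comp, ← Category.assoc]
        congr 1
        exact hT.hom_ext _ _
      · rw [← L.map_comp, coprod.inr_map, ← cancel_epi (L.objObjPreimageIso Y).inv,
          ← Category.assoc, ← hY, L.map_comp, ← Category.assoc]
        congr 1
        exact hT.hom_ext _ _
    subst hf
    have pl : IsPullback ((L.objObjPreimageIso X).inv ≫ L.map coprod.inl) αX
        (L.map (coprod.map (terminal.from _) (terminal.from _))) (L.map coprod.inl) :=
      (isPullback_map L W (FinitaryExtensive.isPullback_inl_map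
        (terminal.from (L.objPreimage X)) (terminal.from (L.objPreimage Y)))).of_iso
        (L.objObjPreimageIso X) (Iso.refl _) (Iso.refl _) (Iso.refl _)
        (by simp) (hT.hom_ext _ _) (by simp) (by simp)
    have pr : IsPullback ((L.objObjPreimageIso Y).inv ≫ L.map coprod.inr) αY
        (L.map (coprod.map (terminal.from _) (terminal.from _))) (L.map coprod.inr) :=
      (isPullback_map L W (FinitaryExtensive.isPullback_inr_map
        (terminal.from (L.objPreimage X)) (terminal.from (L.objPreimage Y)))).of_iso
        (L.objObjPreimageIso Y) (Iso.refl _) (Iso.refl _) (Iso.refl _)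
        (by simp) (hT.hom_ext _ _) (by simp) (by simp)
    exact ⟨pl, pr⟩
  · intro Z f
    refine Nonempty.some ?_
    change Z ⟶ L.obj ((⊤_ C) ⨿ ⊤_ C) at f
    obtain ⟨X, e, f', hf⟩ := exists_iso_hom_comp_eq_map L W f
    have pl := IsPullback.of_hasPullback f' (coprod.inl : ⊤_ C ⟶ _)
    have pr := IsPullback.of_hasPullback f' (coprod.inr : ⊤_ C ⟶ _)
    obtain ⟨h⟩ := FinitaryExtensive.nonempty_isColimit_of_isPullback pl pr
    have := preservesFiniteCoproducts_of_finitaryExtensive L W hW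
    have h' := BinaryCofan.isColimitMapConeEquiv (isColimitOfPreserves L h)
    have pl' : IsPullback (L.map (pullback.fst f' coprod.inl) ≫ e.hom) (L.map (pullback.snd _ _))
        f (L.map coprod.inl) := (isPullback_map L W pl).of_iso (Iso.refl _) e (Iso.refl _)
          (Iso.refl _) (by simp) (by simp) (by simp [hf]) (by simp)
    have pr' : IsPullback (L.map (pullback.fst f' coprod.inr) ≫ e.hom) (L.map (pullback.snd _ _))
        f (L.map coprod.inr) := (isPullback_map L W pr).of_iso (Iso.refl _) e (Iso.refl _)
          (Iso.refl _) (by simp) (by simp) (by simp [hf]) (by simp)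
    exact BinaryCofan.nonempty_isColimit_of_iso h' pl'.isoPullback pr'.isoPullback e
      pl'.isoPullback_hom_fst.symm pr'.isoPullback_hom_fst.symm

end Extensive

end Localization

end CategoryTheory

namespace FlatPaper

/-- Localization of a lextensive category at a lextensive congruence.  If `W` contains
the isomorphisms, has the two-out-of-three property, and is stable under pullback and
finite coproducts, then `C[W⁻¹]` is lextensive, the localization functor preserves
finite limits and finite coproducts, and a functor out of `C[W⁻¹]` preserves finite
limits and finite coproducts iff its composite with the localization functor does. -/
theorem lextensive_localization
    {C : Type u} [Category.{v} C] [HasFiniteLimits C] [FinitaryExtensive C]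
    (W : MorphismProperty C)
    (hiso : ∀ {X Y : C} (f : X ⟶ Y), IsIso f → W f)
    [W.HasTwoOutOfThreeProperty] [W.IsStableUnderBaseChange]
    (hcoprod : ∀ {a b a' b' : C} (f : a ⟶ b) (g : a' ⟶ b'),
      W f → W g → W (coprod.map f g)) :
    HasFiniteLimits W.Localization ∧ FinitaryExtensive W.Localization ∧
    PreservesFiniteLimits W.Q ∧ PreservesFiniteCoproducts W.Q ∧
    ∀ (B : Type u₂) [Category.{v₂} B],
      HasFiniteLimits B → HasFiniteCoproducts B →
      ∀ (G : W.Localization ⥤ B),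
        ((PreservesFiniteLimits G ∧ PreservesFiniteCoproducts G) ↔
          (PreservesFiniteLimits (W.Q ⋙ G) ∧
            PreservesFiniteCoproducts (W.Q ⋙ G))) := by
  have : W.ContainsIdentities := ⟨fun X ↦ hiso (𝟙 X) inferInstance⟩
  have : W.IsMultiplicative := {}
  have := W.hasRightCalculusOfFractions_of_isStableUnderBaseChange
  have := Localization.preservesFiniteLimits_of_hasRightCalculusOfFractions W.Q W
  have := Localization.preservesFiniteCoproducts_of_finitaryExtensive W.Q W hcoprod
  refine ⟨Localization.hasFiniteLimits_of_hasRightCalculusOfFractions W.Q W,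
    Localization.finitaryExtensive W.Q W hcoprod, inferInstance, inferInstance,
    fun B _ _ _ G ↦ ⟨fun ⟨_, _⟩ ↦ ⟨inferInstance, inferInstance⟩, fun ⟨_, _⟩ ↦
      ⟨Localization.preservesFiniteLimits_of_comp W.Q W G,
        Localization.preservesFiniteCoproducts_of_comp W.Q W hcoprod G⟩⟩⟩

end FlatPaper
end

section
/- Let E be a small category with finite limits and finite coproducts, U an ultrafilter on a set X, and (F_x)_{x∈X} a family of functors E ⥤ Type each of which preserves finite limits and finite coproducts. Then the categorical ultraproduct of (F_x) over U, computed in the functor category [E, Type] (which has all small products and all filtered colimits, computed pointwise), preserves finite limits and finite coproducts. -/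
open CategoryTheory CategoryTheory.Limits Opposite

universe w v u v₂ u₂ v₃ u₃

namespace FlatPaper

section Ultra

variable {M : Type u} [Category.{v} M]

/-- The ultrafilter `U`, regarded as a poset under reverse inclusion. -/
def UltraPoset {X : Type w} (U : Ultrafilter X) : Type w := {S : Set X // S ∈ U}

instance {X : Type w} (U : Ultrafilter X) : Preorder (UltraPoset U) where
  le S T := T.1 ⊆ S.1
  le_refl S := subset_rfl
  le_trans S T V h1 h2 := fun x hx => h1 (h2 hx)

instance {X : Type w} (U : Ultrafilter X) : Nonempty (UltraPoset U) :=
  ⟨⟨Set.univ, U.univ_mem⟩⟩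

instance {X : Type w} (U : Ultrafilter X) :
    IsDirected (UltraPoset U) (· ≤ ·) where
  directed S T := ⟨⟨S.1 ∩ T.1, U.inter_mem S.2 T.2⟩,
    fun _ hx => hx.1, fun _ hx => hx.2⟩

/-- A morphism in the ultrafilter poset corresponds to a reverse inclusion. -/
def UltraPoset.subset {X : Type w} {U : Ultrafilter X} {S T : UltraPoset U} (h : S ⟶ T) :
    T.1 ⊆ S.1 := leOfHom h

/-- The diagram `S ↦ ∏_{s ∈ S} f s` over the ultrafilter poset, whose transition maps
are the canonical projections between products.  The categorical ultraproduct of the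
family `f` over `U` is the colimit of this diagram. -/
noncomputable def ultraDiagram {X : Type w} (U : Ultrafilter X) (f : X → M)
    [∀ S : Set X, HasProduct fun s : S => f s] :
    UltraPoset U ⥤ M where
  obj S := ∏ᶜ fun s : S.1 => f s
  map {S T} h := Pi.lift fun t => Pi.π (fun s : S.1 => f s) ⟨t.1, UltraPoset.subset h t.2⟩
  map_id S := by
    apply Pi.hom_ext
    intro t
    simp
  map_comp {S T V} g h := by
    apply Pi.hom_ext
    intro t
    simp

end Ultra

/-- Functors preserving limits of shape `K` are stable under limits of functors. -/
lemma preservesLimitsOfShape_of_isLimit {J K K' C : Type*} [Category* J] [Category* K]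
    [Category* K'] [Category* C] [HasLimitsOfShape K' C] {D : K' ⥤ J ⥤ C} {c : Cone D}
    (hc : IsLimit c) (hD : ∀ k, PreservesLimitsOfShape K (D.obj k)) :
    PreservesLimitsOfShape K c.pt := by
  have : PreservesLimitsOfShape K D.flip := ⟨fun {F} ↦ ⟨fun {t} ht ↦
    ⟨evaluationJointlyReflectsLimits _ fun k ↦ isLimitOfPreserves (D.obj k) ht⟩⟩⟩
  let e : D.flip ⋙ lim ≅ c.pt := NatIso.ofComponents
    (fun j ↦ (limit.isLimit (D.flip.obj j)).conePointUniqueUpToIso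
      (isLimitOfPreserves ((evaluation _ _).obj j) hc))
    (fun f ↦ by
      refine (isLimitOfPreserves ((evaluation _ _).obj _) hc).hom_ext fun k ↦ ?_
      have h₁ := fun j ↦ IsLimit.conePointUniqueUpToIso_hom_comp (limit.isLimit (D.flip.obj j))
        (isLimitOfPreserves ((evaluation _ _).obj j) hc) k
      have h₂ := fun j {Z : C} (g : (D.obj k).obj j ⟶ Z) ↦ IsLimit.conePointUniqueUpToIso_hom_comp_assoc
        (limit.isLimit (D.flip.obj j)) (isLimitOfPreserves ((evaluation _ _).obj j) hc) k g
      dsimp at h₁ h₂ ⊢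
      simp [h₁, h₂])
  exact preservesLimitsOfShape_of_natIso e

section Ultraproduct

variable {E : Type u} [SmallCategory E] {X : Type u}

instance (U : Ultrafilter X) : IsFiltered (UltraPoset U) := isFiltered_of_directed_le_nonempty _

lemma preservesFiniteLimits_colimit_ultraDiagram (U : Ultrafilter X) (F : X → (E ⥤ Type u))
    (hF : ∀ x, PreservesFiniteLimits (F x)) :
    PreservesFiniteLimits (colimit (ultraDiagram U F)) where
  preservesFiniteLimits K _ _ :=
    (ObjectProperty.preservesLimitsOfShape K).prop_colimit _ fun _ ↦
      preservesLimitsOfShape_of_isLimit (limit.isLimit _) fun x ↦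
        (hF x.as.1).preservesFiniteLimits K

/-- The `x`-th coordinate of an element of a pointwise product of functors. -/
noncomputable def coord {F : X → (E ⥤ Type u)} {S : Set X} {A : E}
    (a : (∏ᶜ fun s : S ↦ F s).obj A) (s : X) (hs : s ∈ S) : (F s).obj A :=
  (Pi.π (fun s : S ↦ F s) ⟨s, hs⟩).app A a

variable {F : X → (E ⥤ Type u)}

lemma coord_ext {S : Set X} {A : E} {a b : (∏ᶜ fun s : S ↦ F s).obj A}
    (h : ∀ s hs, coord a s hs = coord b s hs) : a = b :=
  Concrete.isLimit_ext _ (isLimitOfPreserves ((evaluation E (Type u)).obj A)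
    (limit.isLimit (Discrete.functor fun s : S ↦ F s))) a b fun s ↦ h s.as.1 s.as.2

lemma exists_coord_eq {S : Set X} {A : E} (a : ∀ s ∈ S, (F s).obj A) :
    ∃ b : (∏ᶜ fun s : S ↦ F s).obj A, ∀ s hs, coord b s hs = a s hs := by
  refine ⟨(piObjIso (fun s : S ↦ F s) A).inv
    ((Types.productIso.{u, u} fun s : S ↦ (F s).obj A).inv fun s ↦ a s s.2), fun s hs ↦ ?_⟩
  refine (ConcreteCategory.congr_hom (piObjIso_inv_comp_π (fun s : S ↦ F s) A ⟨s, hs⟩) _).trans ?_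
  exact ConcreteCategory.congr_hom
    (Types.productIso_inv_comp_π.{u, u} (fun s : S ↦ (F s).obj A) ⟨s, hs⟩) _

lemma coord_map {S : Set X} {A B : E} (f : A ⟶ B) (a : (∏ᶜ fun s : S ↦ F s).obj A)
    (s : X) (hs : s ∈ S) :
    coord ((∏ᶜ fun s : S ↦ F s).map f a) s hs = (F s).map f (coord a s hs) :=
  NatTrans.naturality_apply (Pi.π (fun s : S ↦ F s) ⟨s, hs⟩) f a

variable {U : Ultrafilter X}

lemma coord_ultraDiagram_map {S T : UltraPoset U} (h : S ⟶ T) {A : E}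
    (a : ((ultraDiagram U F).obj S).obj A) (s : X) (hs : s ∈ T.1) :
    coord (((ultraDiagram U F).map h).app A a) s hs = coord a s (UltraPoset.subset h hs) :=
  ConcreteCategory.congr_hom (NatTrans.congr_app (Pi.lift_π
    (fun t : T.1 ↦ Pi.π (fun s : S.1 ↦ F s) ⟨t.1, UltraPoset.subset h t.2⟩) ⟨s, hs⟩) A) a

/-- The element of the ultraproduct represented by a family defined on a set of the ultrafilter. -/
noncomputable def germ {S : UltraPoset U} {A : E} (a : (∏ᶜ fun s : S.1 ↦ F s).obj A) :
    (colimit (ultraDiagram U F)).obj A :=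
  (colimit.ι (ultraDiagram U F) S).app A a

lemma exists_germ_eq {A : E} (x : (colimit (ultraDiagram U F)).obj A) :
    ∃ (S : UltraPoset U) (a : (∏ᶜ fun s : S.1 ↦ F s).obj A), germ a = x :=
  Types.jointly_surjective_of_isColimit (isColimitOfPreserves ((evaluation E (Type u)).obj A)
    (colimit.isColimit (ultraDiagram U F))) x

lemma germ_eq_germ_iff {A : E} {S T : UltraPoset U} {a : (∏ᶜ fun s : S.1 ↦ F s).obj A}
    {b : (∏ᶜ fun s : T.1 ↦ F s).obj A} :
    germ a = germ b ↔ ∃ V : UltraPoset U, ∃ (hS : V.1 ⊆ S.1) (hT : V.1 ⊆ T.1),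
      ∀ s hs, coord a s (hS hs) = coord b s (hT hs) := by
  refine (Types.FilteredColimit.isColimit_eq_iff _
    (isColimitOfPreserves ((evaluation E (Type u)).obj A)
      (colimit.isColimit (ultraDiagram U F)))).trans ?_
  constructor
  · rintro ⟨V, f, g, h⟩
    refine ⟨V, UltraPoset.subset f, UltraPoset.subset g, fun s hs ↦ ?_⟩
    exact (coord_ultraDiagram_map f a s hs).symm.trans
      ((congrArg (fun c ↦ coord c s hs) h).trans (coord_ultraDiagram_map g b s hs))
  · rintro ⟨V, hS, hT, h⟩
    refine ⟨V, homOfLE hS, homOfLE hT, coord_ext fun s hs ↦ ?_⟩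
    exact (coord_ultraDiagram_map _ a s hs).trans
      ((h s hs).trans (coord_ultraDiagram_map _ b s hs).symm)

lemma map_germ {A B : E} (f : A ⟶ B) {S : UltraPoset U} (a : (∏ᶜ fun s : S.1 ↦ F s).obj A) :
    (colimit (ultraDiagram U F)).map f (germ a) = germ ((∏ᶜ fun s : S.1 ↦ F s).map f a) :=
  (NatTrans.naturality_apply (colimit.ι (ultraDiagram U F) S) f a).symm

lemma preservesColimitsOfShape_discrete_colimit_ultraDiagram (J : Type) [Finite J]
    (hF : ∀ x, PreservesColimitsOfShape (Discrete J) (F x)) :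
    PreservesColimitsOfShape (Discrete J) (colimit (ultraDiagram U F)) := by
  suffices ∀ A : J → E, PreservesColimit (Discrete.functor A) (colimit (ultraDiagram U F)) from
    preservesColimitsOfShape_of_discrete _
  refine fun A ↦ ⟨fun {c : Cofan A} hc ↦ ⟨?_⟩⟩
  have hcF (x : X) : IsColimit (Cofan.mk _ fun j ↦ (F x).map (c.inj j)) :=
    Cofan.isColimitMapCoconeEquiv _ _ _ (isColimitOfPreserves (F x) hc)
  refine (Cofan.isColimitMapCoconeEquiv _ _ _).symm (Nonempty.some ?_)
  rw [← Cofan.isColimit_cofanTypes_iff]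
  refine CofanTypes.isColimit_mk _ (fun x ↦ ?_) (fun j x y h ↦ ?_) (fun i j x y h ↦ ?_)
  · obtain ⟨S, a, rfl⟩ := exists_germ_eq x
    choose i b hb using fun s hs ↦ Cofan.inj_jointly_surjective_of_isColimit (hcF s) (coord a s hs)
    obtain ⟨j, -, hj⟩ := (Ultrafilter.finite_biUnion_mem_iff (f := U)
      (s := fun j ↦ {s | ∃ hs : s ∈ S.1, i s hs = j}) (Set.finite_univ (α := J))).1
        (Filter.mem_of_superset S.2 fun s hs ↦ by simpa using hs)
    obtain ⟨d, hd⟩ := exists_coord_eq (F := F) (S := {s | ∃ hs : s ∈ S.1, i s hs = j})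
      (A := A j) fun s hs ↦ hs.2 ▸ b s hs.1
    refine ⟨j, germ (S := ⟨_, hj⟩) d, (map_germ _ _).trans (germ_eq_germ_iff.2
      ⟨⟨_, hj⟩, subset_rfl, fun s hs ↦ hs.1, fun s hs ↦ ?_⟩)⟩
    rw [coord_map, hd, ← hb]
    obtain ⟨hs, rfl⟩ := hs
    rfl
  · obtain ⟨S, a, rfl⟩ := exists_germ_eq x
    obtain ⟨T, b, rfl⟩ := exists_germ_eq y
    obtain ⟨V, hS, hT, hV⟩ := germ_eq_germ_iff.1
      ((map_germ _ _).symm.trans (h.trans (map_germ _ _)))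
    refine germ_eq_germ_iff.2 ⟨V, hS, hT, fun s hs ↦ ?_⟩
    have := hV s hs
    rw [coord_map, coord_map] at this
    exact Cofan.inj_injective_of_isColimit (hcF s) j this
  · obtain ⟨S, a, rfl⟩ := exists_germ_eq x
    obtain ⟨T, b, rfl⟩ := exists_germ_eq y
    obtain ⟨V, hS, hT, hV⟩ := germ_eq_germ_iff.1
      ((map_germ _ _).symm.trans (h.trans (map_germ _ _)))
    obtain ⟨s, hs⟩ := U.nonempty_of_mem V.2
    have := hV s hs
    rw [coord_map, coord_map] at this
    exact Cofan.eq_of_inj_apply_eq_of_isColimit (hcF s) _ _ this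

end Ultraproduct

/-- For a small category `E` with finite limits and finite coproducts, the categorical
ultraproduct (in `[E, Type]`) of a family of functors preserving finite limits and
finite coproducts again preserves finite limits and finite coproducts. -/
theorem ultraproduct_preserves {E : Type u} [SmallCategory E]
    [HasFiniteLimits E] [HasFiniteCoproducts E]
    {X : Type u} (U : Ultrafilter X) (F : X → (E ⥤ Type u))
    (h₁ : ∀ x : X, PreservesFiniteLimits (F x))
    (h₂ : ∀ x : X, PreservesFiniteCoproducts (F x)) :
    PreservesFiniteLimits (colimit (ultraDiagram U F)) ∧
      PreservesFiniteCoproducts (colimit (ultraDiagram U F)) := by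
  exact ⟨preservesFiniteLimits_colimit_ultraDiagram U F h₁,
    ⟨fun n ↦ preservesColimitsOfShape_discrete_colimit_ultraDiagram (Fin n)
      fun x ↦ (h₂ x).preserves n⟩⟩

end FlatPaper
end

section
/- Let C be a small category and let H be a set of finite cones in the functor category [C, Type], each of the form (c_i : P → P_i)_{i≤n} where P and every P_i are finitely presentable, i.e. the hom functor Hom(P, -) : [C, Type] ⥤ Type preserves filtered colimits (and likewise for each P_i). Let M be the full subcategory of [C, Type] spanned by the objects injective with respect to every cone in H, where an object M is injective with respect to a cone (c_i : P → P_i)_{i≤n} if every morphism P → M factors through c_i for some i ≤ n. Then M is closed in [C, Type] under filtered colimits and under categorical ultraproducts. -/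
open CategoryTheory CategoryTheory.Limits Opposite

universe w v u v₂ u₂ v₃ u₃

namespace FlatPaper

/-- `P : C ⥤ Type` is finitely presentable: `Hom(P, -) : [C, Type] ⥤ Type` preserves
filtered colimits. -/
def FinPres {C : Type u} [SmallCategory C] (P : C ⥤ Type u) : Prop :=
  ∀ (J : Type u) [SmallCategory J] [IsFiltered J],
    PreservesColimitsOfShape J (coyoneda.obj (op P))

/-- `M` is injective with respect to the finite cone `(c i k : P i ⟶ Q i k)_{k ≤ n i}`
for every `i`: every morphism `P i ⟶ M` factors through some `c i k`. -/
def FcInjective {C : Type u} [SmallCategory C] {ι : Type u} {n : ι → ℕ}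
    {P : ι → C ⥤ Type u} {Q : (i : ι) → Fin (n i) → (C ⥤ Type u)}
    (c : (i : ι) → (k : Fin (n i)) → (P i ⟶ Q i k)) (M : C ⥤ Type u) : Prop :=
  ∀ (i : ι) (h : P i ⟶ M), ∃ (k : Fin (n i)) (g : Q i k ⟶ M), c i k ≫ g = h

/-- A morphism from a finitely presentable object to a filtered colimit factors through
some stage of the diagram. -/
lemma FinPres.exists_factor {C : Type u} [SmallCategory C] {P : C ⥤ Type u} (hP : FinPres P)
    {J : Type u} [SmallCategory J] [IsFiltered J] (G : J ⥤ (C ⥤ Type u))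
    (h : P ⟶ colimit G) : ∃ (j : J) (g : P ⟶ G.obj j), g ≫ colimit.ι G j = h := by
  have := hP J
  exact Types.jointly_surjective_of_isColimit
    (isColimitOfPreserves (coyoneda.obj (op P)) (colimit.isColimit G)) h

lemma ultraDiagram_map_π {M : Type u} [Category.{v} M] {X : Type w} (U : Ultrafilter X)
    (f : X → M) [∀ S : Set X, HasProduct fun s : S => f s] {S T : UltraPoset U} (r : S ⟶ T)
    (t : T.1) :
    (ultraDiagram U f).map r ≫ Pi.π (fun s : T.1 => f s) t =
      Pi.π (fun s : S.1 => f s) ⟨t.1, UltraPoset.subset r t.2⟩ :=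
  Pi.lift_π (fun t : T.1 => Pi.π (fun s : S.1 => f s) ⟨t.1, UltraPoset.subset r t.2⟩) t

/-- A finite fc-injectivity class in `[C, Type]`, w.r.t. a set of finite cones with
finitely presentable domains and codomains, is closed under filtered colimits and
under categorical ultraproducts. -/
theorem fcInjectivity_closed {C : Type u} [SmallCategory C]
    (ι : Type u) (n : ι → ℕ) (P : ι → C ⥤ Type u)
    (Q : (i : ι) → Fin (n i) → (C ⥤ Type u))
    (c : (i : ι) → (k : Fin (n i)) → (P i ⟶ Q i k))
    (hP : ∀ i, FinPres (P i)) (hQ : ∀ i k, FinPres (Q i k)) :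
    (∀ (J : Type u) [SmallCategory J] [IsFiltered J] (G : J ⥤ (C ⥤ Type u)),
        (∀ j : J, FcInjective c (G.obj j)) → FcInjective c (colimit G)) ∧
    (∀ (X : Type u) (U : Ultrafilter X) (f : X → (C ⥤ Type u)),
        (∀ x : X, FcInjective c (f x)) → FcInjective c (colimit (ultraDiagram U f))) := by
  refine ⟨fun J _ _ G hG i h => ?_, fun X U f hf i h => ?_⟩
  · obtain ⟨j, h, rfl⟩ := (hP i).exists_factor G h
    obtain ⟨k, g, rfl⟩ := hG j i h
    exact ⟨k, g ≫ colimit.ι G j, (Category.assoc _ _ _).symm⟩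
  · obtain ⟨S, h, rfl⟩ := (hP i).exists_factor (ultraDiagram U f) h
    let A (k : Fin (n i)) : Set X :=
      {x | ∃ (hx : x ∈ S.1) (g : Q i k ⟶ f x),
        c i k ≫ g = h ≫ Pi.π (fun s : S.1 => f s) ⟨x, hx⟩}
    have hS : S.1 ⊆ ⋃ k ∈ (Set.univ : Set (Fin (n i))), A k := fun x hx => by
      obtain ⟨k, g, hg⟩ := hf x i (h ≫ Pi.π (fun s : S.1 => f s) ⟨x, hx⟩)
      exact Set.mem_biUnion (Set.mem_univ k) ⟨hx, g, hg⟩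
    obtain ⟨k, -, hk⟩ :=
      (Ultrafilter.finite_biUnion_mem_iff Set.finite_univ).1 (Filter.mem_of_superset S.2 hS)
    let T : UltraPoset U := ⟨A k, hk⟩
    let r : S ⟶ T := homOfLE fun _ hx => hx.1
    choose hx g hg using fun t : T.1 => t.2
    let l : Q i k ⟶ (ultraDiagram U f).obj T := Pi.lift g
    have key : c i k ≫ l = h ≫ (ultraDiagram U f).map r := by
      refine Pi.hom_ext _ _ fun t => ?_
      calc (c i k ≫ l) ≫ Pi.π (fun s : T.1 => f s) t = c i k ≫ g t :=
            (Category.assoc _ _ _).trans (congrArg (c i k ≫ ·) (Pi.lift_π g t))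
        _ = h ≫ Pi.π (fun s : S.1 => f s) ⟨t.1, hx t⟩ := hg t
        _ = (h ≫ (ultraDiagram U f).map r) ≫ Pi.π (fun s : T.1 => f s) t :=
            ((Category.assoc _ _ _).trans (congrArg (h ≫ ·) (ultraDiagram_map_π U f r t))).symm
    refine ⟨k, l ≫ colimit.ι (ultraDiagram U f) T, ?_⟩
    rw [← Category.assoc, key, Category.assoc, colimit.w]

end FlatPaper
end
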